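/- Let ρ = e^{−V} be a probability density on ℝⁿ with V : ℝⁿ → ℝ convex, and for δ > 0 let m_δ be the unique point satisfying ∫ x e^{−δ|x−m_δ|²/2} ρ(x) dx = m_δ ∫ e^{−δ|x−m_δ|²/2} ρ(x) dx. Then for every δ > 0: −log( ∫_{ℝⁿ} e^{−δ|x−m_δ|²/2} ρ(x) dx ) ≤ (δ/2)·Var(ρ) if δ < n/Var(ρ), and −log( ∫_{ℝⁿ} e^{−δ|x−m_δ|²/2} ρ(x) dx ) ≤ (n/2)·( 1 + log( (δ/n)·Var(ρ) ) ) if δ ≥ n/Var(ρ). -/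

import Mathlib

open MeasureTheory
open scoped Pointwise

theorem volume_add_volume_le_of_isCompact {K L C : Set ℝ} (hK : IsCompact K) (hL : IsCompact L)
    (hK₀ : K.Nonempty) (hL₀ : L.Nonempty) (h : ∀ x ∈ K, ∀ y ∈ L, x + y ∈ C) :
    volume K + volume L ≤ volume C := by
  obtain ⟨p, hpK, hp⟩ := hK.exists_isGreatest hK₀
  obtain ⟨q, hqL, hq⟩ := hL.exists_isLeast hL₀
  have hK' : volume ((fun x => x + q) '' K) = volume K := by simp
  have hL' : volume ((fun y => p + y) '' L) = volume L := by simp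
  have hdisj : AEDisjoint volume ((fun x => x + q) '' K) ((fun y => p + y) '' L) := by
    refine measure_mono_null (t := {p + q}) ?_ (by simp)
    rintro _ ⟨⟨x, hx, rfl⟩, ⟨y, hy, hxy⟩⟩
    have h₁ := hp hx
    have h₂ := hq hy
    simp only [Set.mem_singleton_iff] at hxy ⊢
    linarith
  have hmeas : MeasurableSet ((fun y => p + y) '' L) :=
    (hL.image (by fun_prop)).isClosed.measurableSet
  rw [← hK', ← hL', ← measure_union₀ hmeas.nullMeasurableSet hdisj]
  refine measure_mono ?_
  rintro _ (⟨x, hx, rfl⟩ | ⟨y, hy, rfl⟩)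
  · exact h x hx q hqL
  · exact h p hpK y hy

/-- The one-dimensional Brunn-Minkowski inequality. -/
theorem volume_add_volume_le {A B C : Set ℝ} (hA : MeasurableSet A) (hB : MeasurableSet B)
    (hA₀ : A.Nonempty) (hB₀ : B.Nonempty) (h : ∀ x ∈ A, ∀ y ∈ B, x + y ∈ C) :
    volume A + volume B ≤ volume C := by
  obtain ⟨x₀, hx₀⟩ := hA₀
  obtain ⟨y₀, hy₀⟩ := hB₀
  rw [hA.measure_eq_iSup_isCompact, hB.measure_eq_iSup_isCompact]
  simp only [iSup_and']
  refine ENNReal.biSup_add_biSup_le' ⟨∅, by simp⟩ ⟨∅, by simp⟩ ?_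
  rintro K ⟨hKA, hK⟩ L ⟨hLB, hL⟩
  refine (add_le_add (measure_mono (Set.subset_insert x₀ K))
    (measure_mono (Set.subset_insert y₀ L))).trans ?_
  refine volume_add_volume_le_of_isCompact (hK.insert x₀) (hL.insert y₀)
    (Set.insert_nonempty _ _) (Set.insert_nonempty _ _) fun x hx y hy => h x ?_ y ?_
  · exact Set.insert_subset hx₀ hKA hx
  · exact Set.insert_subset hy₀ hLB hy

theorem lintegral_add_le_of_superlevel {f g h : ℝ → ℝ} (hf : Measurable f) (hg : Measurable g)
    (hh : Measurable h) (hf₀ : 0 ≤ f) (hg₀ : 0 ≤ g) (hh₀ : 0 ≤ h) (hf₁ : ∀ x, f x ≤ 1)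
    (hg₁ : ∀ x, g x ≤ 1) (hf_sup : ∀ t < 1, ∃ x, t < f x) (hg_sup : ∀ t < 1, ∃ x, t < g x)
    {a b : ℝ} (ha : 0 < a) (hb : 0 < b)
    (H : ∀ t x y, 0 < t → t < f x → t < g y → t < h (a * x + b * y)) :
    ENNReal.ofReal a * (∫⁻ x, ENNReal.ofReal (f x)) +
      ENNReal.ofReal b * (∫⁻ x, ENNReal.ofReal (g x)) ≤ ∫⁻ x, ENNReal.ofReal (h x) := by
  rw [lintegral_eq_lintegral_meas_lt _ (.of_forall hf₀) hf.aemeasurable,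
    lintegral_eq_lintegral_meas_lt _ (.of_forall hg₀) hg.aemeasurable,
    lintegral_eq_lintegral_meas_lt _ (.of_forall hh₀) hh.aemeasurable,
    ← lintegral_const_mul' _ _ ENNReal.ofReal_ne_top,
    ← lintegral_const_mul' _ _ ENNReal.ofReal_ne_top, ← lintegral_add_left]
  · refine setLIntegral_mono' measurableSet_Ioi fun t ht => ?_
    rcases le_or_gt 1 t with h1 | h1
    · have hf' : {x | t < f x} = ∅ := by
        ext x; simpa using (hf₁ x).trans h1
      have hg' : {x | t < g x} = ∅ := by
        ext x; simpa using (hg₁ x).trans h1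
      simp [hf', hg']
    · have key : ∀ (c : ℝ), 0 < c → ∀ s : Set ℝ,
          ENNReal.ofReal c * volume s = volume (c • s) := by
        intro c hc s
        simp [Measure.addHaar_smul, abs_of_pos hc]
      rw [key a ha, key b hb]
      refine volume_add_volume_le ((measurableSet_lt measurable_const hf).const_smul₀ a)
        ((measurableSet_lt measurable_const hg).const_smul₀ b)
        (Set.Nonempty.smul_set (hf_sup t h1)) (Set.Nonempty.smul_set (hg_sup t h1)) ?_
      rintro _ ⟨x, hx, rfl⟩ _ ⟨y, hy, rfl⟩
      exact H t x y ht hx hy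
  · refine Measurable.const_mul ?_ _
    refine Antitone.measurable fun s t hst => measure_mono fun x hx => ?_
    exact lt_of_le_of_lt hst hx

theorem ENNReal.rpow_mul_rpow_le_weighted_add {a b : ℝ} (ha : 0 < a) (hb : 0 < b)
    (hab : a + b = 1) (x y : ENNReal) :
    x ^ a * y ^ b ≤ ENNReal.ofReal a * x + ENNReal.ofReal b * y := by
  rcases eq_or_ne x ⊤ with rfl | hx
  · simp [ENNReal.mul_top, ha]
  rcases eq_or_ne y ⊤ with rfl | hy
  · simp [ENNReal.mul_top, hb]
  rw [← ENNReal.ofReal_toReal hx, ← ENNReal.ofReal_toReal hy,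
    ENNReal.ofReal_rpow_of_nonneg ENNReal.toReal_nonneg ha.le,
    ENNReal.ofReal_rpow_of_nonneg ENNReal.toReal_nonneg hb.le,
    ← ENNReal.ofReal_mul (by positivity), ← ENNReal.ofReal_mul ha.le, ← ENNReal.ofReal_mul hb.le,
    ← ENNReal.ofReal_add (by positivity) (by positivity)]
  exact ENNReal.ofReal_le_ofReal (Real.geom_mean_le_arith_mean2_weighted ha.le hb.le
    ENNReal.toReal_nonneg ENNReal.toReal_nonneg hab)

theorem ENNReal.div_mul_div_comm_of_ne {u v c d : ENNReal} (hc : c ≠ 0) (hc' : c ≠ ⊤) :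
    u / c * (v / d) = u * v / (c * d) := by
  rw [div_eq_mul_inv, div_eq_mul_inv, div_eq_mul_inv,
    ENNReal.mul_inv (.inl hc) (.inl hc'), mul_mul_mul_comm]

theorem prekopa_leindler_real_of_bounded {f g h : ℝ → ENNReal} (hf : Measurable f)
    (hg : Measurable g) (hh : Measurable h) {M : ENNReal} (hM : M ≠ ⊤) (hfM : ∀ x, f x ≤ M)
    (hgM : ∀ x, g x ≤ M) {a b : ℝ} (ha : 0 < a) (hb : 0 < b) (hab : a + b = 1)
    (H : ∀ x y, f x ^ a * g y ^ b ≤ h (a * x + b * y)) :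
    (∫⁻ x, f x) ^ a * (∫⁻ x, g x) ^ b ≤ ∫⁻ x, h x := by
  set A := ⨆ x, f x with hA
  set B := ⨆ x, g x with hB
  have hfA : ∀ x, f x ≤ A := le_iSup f
  have hgB : ∀ x, g x ≤ B := le_iSup g
  rcases eq_or_ne A 0 with hA0 | hA0
  · have : ∀ x, f x = 0 := fun x => le_antisymm ((hfA x).trans hA0.le) bot_le
    simp [this, ha]
  rcases eq_or_ne B 0 with hB0 | hB0
  · have : ∀ x, g x = 0 := fun x => le_antisymm ((hgB x).trans hB0.le) bot_le
    simp [this, hb]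
  have hAt : A ≠ ⊤ := ((iSup_le hfM).trans_lt hM.lt_top).ne
  have hBt : B ≠ ⊤ := ((iSup_le hgM).trans_lt hM.lt_top).ne
  set D := A ^ a * B ^ b with hD
  have hAa0 : A ^ a ≠ 0 := by simp [ENNReal.rpow_eq_zero_iff, hA0, hAt]
  have hBb0 : B ^ b ≠ 0 := by simp [ENNReal.rpow_eq_zero_iff, hB0, hBt]
  have hAat : A ^ a ≠ ⊤ := ENNReal.rpow_ne_top_of_nonneg ha.le hAt
  have hBbt : B ^ b ≠ ⊤ := ENNReal.rpow_ne_top_of_nonneg hb.le hBt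
  have hD0 : D ≠ 0 := mul_ne_zero hAa0 hBb0
  have hDt : D ≠ ⊤ := ENNReal.mul_ne_top hAat hBbt
  have div_le_one : ∀ {u C : ENNReal}, u ≤ C → u / C ≤ 1 :=
    fun huC => ENNReal.div_le_of_le_mul (by simpa using huC)
  have sup_div : ∀ (u : ℝ → ENNReal), (⨆ x, u x) ≠ 0 → (⨆ x, u x) ≠ ⊤ → ∀ t : ℝ, t < 1 →
      ∃ x, t < (u x / ⨆ x, u x).toReal := by
    intro u hu0 hut t ht
    have hlt : ENNReal.ofReal t * (⨆ x, u x) < ⨆ x, u x := by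
      conv_rhs => rw [← one_mul (⨆ x, u x)]
      exact (ENNReal.mul_lt_mul_iff_left hu0 hut).2 (by simpa using ht)
    obtain ⟨x, hx⟩ := lt_iSup_iff.1 hlt
    refine ⟨x, (show t ≤ (ENNReal.ofReal t).toReal by simp [ENNReal.toReal_ofReal']).trans_lt
      (ENNReal.toReal_strict_mono
      ((div_le_one (le_iSup u x)).trans_lt ENNReal.one_lt_top).ne ?_)⟩
    rwa [ENNReal.lt_div_iff_mul_lt (.inl hu0) (.inl hut)]
  have key := lintegral_add_le_of_superlevel (f := fun x => (f x / A).toReal)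
    (g := fun x => (g x / B).toReal) (h := fun x => (min (h x / D) 1).toReal)
    (by fun_prop) (by fun_prop) (by fun_prop) (fun _ => ENNReal.toReal_nonneg)
    (fun _ => ENNReal.toReal_nonneg) (fun _ => ENNReal.toReal_nonneg)
    (fun x => ENNReal.toReal_le_of_le_ofReal zero_le_one (by simpa using div_le_one (hfA x)))
    (fun x => ENNReal.toReal_le_of_le_ofReal zero_le_one (by simpa using div_le_one (hgB x)))
    (sup_div f hA0 hAt) (sup_div g hB0 hBt) ha hb ?_
  · have hfi : ∫⁻ x, ENNReal.ofReal (f x / A).toReal = (∫⁻ x, f x) / A := by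
      simp only [ENNReal.ofReal_toReal ((div_le_one (hfA _)).trans_lt ENNReal.one_lt_top).ne]
      simp only [div_eq_mul_inv]
      rw [lintegral_mul_const _ hf]
    have hgi : ∫⁻ x, ENNReal.ofReal (g x / B).toReal = (∫⁻ x, g x) / B := by
      simp only [ENNReal.ofReal_toReal ((div_le_one (hgB _)).trans_lt ENNReal.one_lt_top).ne]
      simp only [div_eq_mul_inv]
      rw [lintegral_mul_const _ hg]
    have hhi : ∫⁻ x, ENNReal.ofReal (min (h x / D) 1).toReal ≤ (∫⁻ x, h x) / D := by
      rw [div_eq_mul_inv, ← lintegral_mul_const _ hh]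
      exact lintegral_mono fun x => ENNReal.ofReal_toReal_le.trans (min_le_left _ _)
    rw [hfi, hgi] at key
    have h2 := ((ENNReal.rpow_mul_rpow_le_weighted_add ha hb hab _ _).trans key).trans hhi
    rw [ENNReal.div_rpow_of_nonneg _ _ ha.le, ENNReal.div_rpow_of_nonneg _ _ hb.le,
      ENNReal.div_mul_div_comm_of_ne hAa0 hAat] at h2
    simpa [ENNReal.div_mul_cancel hD0 hDt, ← hD] using mul_le_mul' h2 (le_refl D)
  · intro t x y ht hx hy
    have hx' : ENNReal.ofReal t < f x / A := (ENNReal.ofReal_lt_iff_lt_toReal ht.le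
      ((div_le_one (hfA x)).trans_lt ENNReal.one_lt_top).ne).2 hx
    have hy' : ENNReal.ofReal t < g y / B := (ENNReal.ofReal_lt_iff_lt_toReal ht.le
      ((div_le_one (hgB y)).trans_lt ENNReal.one_lt_top).ne).2 hy
    refine (ENNReal.ofReal_lt_iff_lt_toReal ht.le
      ((min_le_right _ _).trans_lt ENNReal.one_lt_top).ne).1 (lt_min ?_ ?_)
    · have ht0 : ENNReal.ofReal t ≠ 0 := by simpa using ht
      have hprod : ENNReal.ofReal t ^ a * ENNReal.ofReal t ^ b < (f x / A) ^ a * (g y / B) ^ b :=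
        ENNReal.mul_lt_mul (ENNReal.rpow_lt_rpow hx' ha) (ENNReal.rpow_lt_rpow hy' hb)
      rw [← ENNReal.rpow_add _ _ ht0 ENNReal.ofReal_ne_top, hab, ENNReal.rpow_one,
        ENNReal.div_rpow_of_nonneg _ _ ha.le, ENNReal.div_rpow_of_nonneg _ _ hb.le] at hprod
      refine hprod.trans_le ?_
      rw [ENNReal.div_mul_div_comm_of_ne hAa0 hAat]
      exact ENNReal.div_le_div_right (H x y) D
    · exact hx'.trans_le (div_le_one (hfA x))

/-- The Prékopa-Leindler inequality on the real line. -/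
theorem prekopa_leindler_real {f g h : ℝ → ENNReal} (hf : Measurable f)
    (hg : Measurable g) (hh : Measurable h) {a b : ℝ} (ha : 0 < a) (hb : 0 < b) (hab : a + b = 1)
    (H : ∀ x y, f x ^ a * g y ^ b ≤ h (a * x + b * y)) :
    (∫⁻ x, f x) ^ a * (∫⁻ x, g x) ^ b ≤ ∫⁻ x, h x := by
  rcases eq_or_ne (∫⁻ x, f x) 0 with hf0 | hf0
  · simp [hf0, ha]
  rcases eq_or_ne (∫⁻ x, g x) 0 with hg0 | hg0
  · simp [hg0, hb]
  have hlim : ∀ u : ℝ → ENNReal, Measurable u → Filter.Tendsto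
      (fun k : ℕ => ∫⁻ x, min (u x) k) Filter.atTop (nhds (∫⁻ x, u x)) := by
    intro u hu
    refine lintegral_tendsto_of_tendsto_of_monotone (fun k => by fun_prop)
      (.of_forall fun x i j hij => min_le_min le_rfl (by exact_mod_cast hij))
      (.of_forall fun x => ?_)
    simpa using (tendsto_const_nhds (x := u x)).min ENNReal.tendsto_nat_nhds_top
  have hrpow : ∀ (u : ℝ → ENNReal) (c : ℝ), Measurable u → Filter.Tendsto
      (fun k : ℕ => (∫⁻ x, min (u x) k) ^ c) Filter.atTop (nhds ((∫⁻ x, u x) ^ c)) :=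
    fun u c hu => ((ENNReal.continuous_rpow_const).tendsto _).comp (hlim u hu)
  refine le_of_tendsto' (ENNReal.Tendsto.mul (hrpow f a hf) (.inl ?_) (hrpow g b hg) (.inl ?_))
    fun k => prekopa_leindler_real_of_bounded (by fun_prop) (by fun_prop) hh
      (ENNReal.natCast_ne_top k) (fun x => min_le_right _ _) (fun x => min_le_right _ _) ha hb hab
      fun x y => le_trans ?_ (H x y)
  · simp [ENNReal.rpow_eq_zero_iff, hf0, not_lt.2 ha.le]
  · simp [ENNReal.rpow_eq_zero_iff, hg0, not_lt.2 hb.le]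
  · gcongr <;> exact min_le_left _ _

/-- The Prékopa-Leindler inequality. -/
theorem prekopa_leindler {n : ℕ} {f g h : (Fin n → ℝ) → ENNReal} (hf : Measurable f)
    (hg : Measurable g) (hh : Measurable h) {a b : ℝ} (ha : 0 < a) (hb : 0 < b) (hab : a + b = 1)
    (H : ∀ x y, f x ^ a * g y ^ b ≤ h (a • x + b • y)) :
    (∫⁻ x, f x) ^ a * (∫⁻ x, g x) ^ b ≤ ∫⁻ x, h x := by
  induction n with
  | zero =>
    rw [Measure.volume_pi_eq_dirac 0]
    simpa using H 0 0
  | succ n ih =>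
    have hcons := (volume_preserving_piFinSuccAbove (fun _ : Fin (n + 1) => ℝ) 0).symm
    set e := (MeasurableEquiv.piFinSuccAbove (fun _ : Fin (n + 1) => ℝ) 0).symm with he
    have fubini : ∀ u : (Fin (n + 1) → ℝ) → ENNReal, Measurable u →
        ∫⁻ x, u x = ∫⁻ s : ℝ, ∫⁻ y : Fin n → ℝ, u (e (s, y)) := by
      intro u hu
      rw [← hcons.lintegral_comp hu]
      exact lintegral_prod _ (hu.comp e.measurable).aemeasurable
    have hmarg : ∀ u : (Fin (n + 1) → ℝ) → ENNReal, Measurable u →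
        Measurable fun s : ℝ => ∫⁻ y : Fin n → ℝ, u (e (s, y)) :=
      fun u hu => (hu.comp e.measurable).lintegral_prod_right'
    rw [fubini f hf, fubini g hg, fubini h hh]
    refine prekopa_leindler_real (hmarg f hf) (hmarg g hg) (hmarg h hh) ha hb hab fun s t => ?_
    refine ih (by fun_prop) (by fun_prop) (by fun_prop) fun x y => (H _ _).trans_eq ?_
    congr 1
    ext i
    refine Fin.cases ?_ (fun j => ?_) i <;> simp [he, MeasurableEquiv.piFinSuccAbove]

theorem ConvexOn.exists_norm_le_of_integrable_exp_neg {E : Type*} [NormedAddCommGroup E]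
    [NormedSpace ℝ E] [FiniteDimensional ℝ E] [MeasurableSpace E] [BorelSpace E] {μ : Measure E}
    [μ.IsAddHaarMeasure] {V : E → ℝ} (hV : ConvexOn ℝ Set.univ V)
    (hint : Integrable (fun x => Real.exp (-V x)) μ) :
    ∃ R > 0, ∀ x, V x ≤ V 0 + 1 → ‖x‖ ≤ R := by
  have hVc : Continuous V := continuousOn_univ.1 (hV.continuousOn isOpen_univ)
  obtain ⟨r, hr, hball⟩ := Metric.eventually_nhds_iff_ball.1
    ((hVc.tendsto 0).eventually (eventually_le_nhds (lt_add_one (V 0))))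
  have htail := tendsto_setIntegral_of_antitone (μ := μ) (f := fun x => Real.exp (-V x))
    (s := fun k : ℕ => {x : E | (k : ℝ) ≤ ‖x‖})
    (fun k => measurableSet_le measurable_const measurable_norm)
    (fun i j hij x hx => (Nat.cast_le (α := ℝ).2 hij).trans hx) ⟨0, hint.integrableOn⟩
  have hempty : ⋂ k : ℕ, {x : E | (k : ℝ) ≤ ‖x‖} = ∅ := by
    ext x
    simpa using exists_nat_gt ‖x‖
  rw [hempty, setIntegral_empty] at htail
  have hpos : 0 < Real.exp (-(V 0 + 1)) * μ.real (Metric.ball 0 (r / 2)) :=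
    mul_pos (Real.exp_pos _) (ENNReal.toReal_pos (Metric.measure_ball_pos μ _ (by positivity)).ne'
      measure_ball_lt_top.ne)
  obtain ⟨k, hk⟩ := (htail.eventually (gt_mem_nhds hpos)).exists
  refine ⟨2 * k + r, by positivity, fun x hx => ?_⟩
  by_contra! hxk
  refine hk.not_ge ?_
  have hsub : Metric.ball ((1 / 2 : ℝ) • x) (r / 2) ⊆ {y : E | (k : ℝ) ≤ ‖y‖} := by
    intro y hy
    rw [mem_ball_iff_norm] at hy
    have h₁ : ‖(1 / 2 : ℝ) • x‖ = ‖x‖ / 2 := by rw [norm_smul]; norm_num; ring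
    have h₂ := norm_sub_norm_le ((1 / 2 : ℝ) • x) y
    rw [norm_sub_rev] at h₂
    change (k : ℝ) ≤ ‖y‖
    linarith
  have hVle : ∀ y ∈ Metric.ball ((1 / 2 : ℝ) • x) (r / 2), V y ≤ V 0 + 1 := by
    intro y hy
    have hz : (2 : ℝ) • (y - (1 / 2 : ℝ) • x) ∈ Metric.ball (0 : E) r := by
      rw [mem_ball_iff_norm] at hy
      rw [mem_ball_zero_iff, norm_smul]
      norm_num at hy ⊢
      linarith
    have hconv := hV.2 (Set.mem_univ x) (Set.mem_univ ((2 : ℝ) • (y - (1 / 2 : ℝ) • x)))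
      (show (0 : ℝ) ≤ 1 / 2 by norm_num) (show (0 : ℝ) ≤ 1 / 2 by norm_num) (by norm_num)
    have hy' : (1 / 2 : ℝ) • x + (1 / 2 : ℝ) • (2 : ℝ) • (y - (1 / 2 : ℝ) • x) = y := by
      module
    rw [hy'] at hconv
    have := hball _ hz
    simp only [smul_eq_mul] at hconv
    linarith
  calc Real.exp (-(V 0 + 1)) * μ.real (Metric.ball 0 (r / 2))
      = ∫ _ in Metric.ball ((1 / 2 : ℝ) • x) (r / 2), Real.exp (-(V 0 + 1)) ∂μ := by
        rw [setIntegral_const, smul_eq_mul, mul_comm, measureReal_def, measureReal_def,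
          Measure.addHaar_ball_center μ ((1 / 2 : ℝ) • x)]
    _ ≤ ∫ y in Metric.ball ((1 / 2 : ℝ) • x) (r / 2), Real.exp (-V y) ∂μ := by
        refine setIntegral_mono_on (by simp [measure_ball_lt_top]) hint.integrableOn
          measurableSet_ball fun y hy => ?_
        have := hVle y hy
        gcongr
    _ ≤ _ := setIntegral_mono_set hint.integrableOn (.of_forall fun _ => (Real.exp_pos _).le)
        hsub.eventuallyLE

theorem ConvexOn.exists_mul_norm_sub_le_of_integrable_exp_neg {E : Type*} [NormedAddCommGroup E]
    [NormedSpace ℝ E] [FiniteDimensional ℝ E] [MeasurableSpace E] [BorelSpace E] {μ : Measure E}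
    [μ.IsAddHaarMeasure] {V : E → ℝ} (hV : ConvexOn ℝ Set.univ V)
    (hint : Integrable (fun x => Real.exp (-V x)) μ) :
    ∃ a > 0, ∃ b, ∀ x, a * ‖x‖ - b ≤ V x := by
  have hVc : Continuous V := continuousOn_univ.1 (hV.continuousOn isOpen_univ)
  obtain ⟨R, hR, hVR⟩ := hV.exists_norm_le_of_integrable_exp_neg hint
  obtain ⟨c, hc⟩ := ((isCompact_closedBall (0 : E) (R + 1)).image hVc).bddBelow
  refine ⟨1 / (R + 1), by positivity, |V 0| + |c| + 1, fun x => ?_⟩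
  rcases le_or_gt ‖x‖ (R + 1) with hx | hx
  · have h₁ := hc (Set.mem_image_of_mem V (mem_closedBall_zero_iff.2 hx))
    have h₂ : 1 / (R + 1) * ‖x‖ ≤ 1 := by
      rw [one_div_mul_eq_div]
      exact div_le_one_of_le₀ hx (by positivity)
    have := neg_abs_le c
    have := abs_nonneg (V 0)
    linarith
  · have hx0 : 0 < ‖x‖ := by linarith
    set s := (R + 1) / ‖x‖ with hs
    have hs0 : 0 < s := by positivity
    have hs1 : s ≤ 1 := div_le_one_of_le₀ hx.le hx0.le
    have hsx : ‖s • x‖ = R + 1 := by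
      rw [norm_smul, Real.norm_of_nonneg hs0.le, hs]
      field_simp
    have hbig : V 0 + 1 < V (s • x) := by
      by_contra! hle
      linarith [hVR _ hle]
    have hconv := hV.2 (Set.mem_univ x) (Set.mem_univ 0) hs0.le (sub_nonneg.2 hs1) (by ring)
    simp only [smul_zero, add_zero, smul_eq_mul] at hconv
    have h₁ : 1 / s ≤ V x - V 0 := by
      rw [div_le_iff₀ hs0]
      linarith
    have h₂ : 1 / s = 1 / (R + 1) * ‖x‖ := by rw [hs]; field_simp
    have := neg_abs_le (V 0)
    have := abs_nonneg c
    linarith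

theorem ConvexOn.integrable_norm_sq_mul_exp_neg {E : Type*} [NormedAddCommGroup E]
    [NormedSpace ℝ E] [FiniteDimensional ℝ E] [MeasurableSpace E] [BorelSpace E] {μ : Measure E}
    [μ.IsAddHaarMeasure] {V : E → ℝ} (hV : ConvexOn ℝ Set.univ V)
    (hint : Integrable (fun x => Real.exp (-V x)) μ) (c : E) :
    Integrable (fun x => ‖x - c‖ ^ 2 * Real.exp (-V x)) μ := by
  have hVc : Continuous V := continuousOn_univ.1 (hV.continuousOn isOpen_univ)
  obtain ⟨a, ha, b, hab⟩ := hV.exists_mul_norm_sub_le_of_integrable_exp_neg hint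
  have h₀ : Integrable (fun x => ‖x‖ ^ 2 * Real.exp (-V x)) μ := by
    refine ((hint.comp_smul (R := 1 / 2) (by norm_num)).const_mul
      (8 / a ^ 2 * Real.exp (b / 2 + V 0 / 2))).mono' (by fun_prop) (.of_forall fun x => ?_)
    rw [Real.norm_of_nonneg (by positivity)]
    have hconv := hV.2 (Set.mem_univ x) (Set.mem_univ 0)
      (show (0 : ℝ) ≤ 1 / 2 by norm_num) (show (0 : ℝ) ≤ 1 / 2 by norm_num) (by norm_num)
    simp only [smul_zero, add_zero, smul_eq_mul] at hconv
    have h₁ : ‖x‖ ^ 2 ≤ 8 / a ^ 2 * Real.exp (a * ‖x‖ / 2) := by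
      have := Real.quadratic_le_exp_of_nonneg (x := a * ‖x‖ / 2) (by positivity)
      rw [div_mul_eq_mul_div, le_div_iff₀ (by positivity)]
      have : 0 ≤ a * ‖x‖ := by positivity
      nlinarith
    calc ‖x‖ ^ 2 * Real.exp (-V x)
        ≤ 8 / a ^ 2 * Real.exp (a * ‖x‖ / 2) * Real.exp (-V x) := by gcongr
      _ = 8 / a ^ 2 * Real.exp (a * ‖x‖ / 2 - V x) := by
        rw [mul_assoc, ← Real.exp_add, ← sub_eq_add_neg]
      _ ≤ 8 / a ^ 2 * Real.exp (b / 2 + V 0 / 2 + -V ((1 / 2 : ℝ) • x)) := by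
        gcongr
        linarith [hab x]
      _ = _ := by rw [Real.exp_add _ (-V _), mul_assoc]
  refine ((h₀.const_mul 2).add (hint.const_mul (2 * ‖c‖ ^ 2))).mono' (by fun_prop)
    (.of_forall fun x => ?_)
  rw [Real.norm_of_nonneg (by positivity)]
  have h₁ : ‖x - c‖ ^ 2 ≤ 2 * ‖x‖ ^ 2 + 2 * ‖c‖ ^ 2 := by
    have := norm_sub_le x c
    nlinarith [norm_nonneg (x - c), norm_nonneg x, norm_nonneg c, sq_nonneg (‖x‖ - ‖c‖)]
  calc ‖x - c‖ ^ 2 * Real.exp (-V x)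
      ≤ (2 * ‖x‖ ^ 2 + 2 * ‖c‖ ^ 2) * Real.exp (-V x) := by gcongr
    _ = _ := by simp only [Pi.add_apply]; ring

theorem prekopa_leindler_integral_exp_neg {n : ℕ} {F G H : EuclideanSpace ℝ (Fin n) → ℝ}
    (hF : Continuous F) (hG : Continuous G) (hH : Continuous H)
    (hFi : Integrable fun x => Real.exp (-F x)) (hGi : Integrable fun x => Real.exp (-G x))
    (hHi : Integrable fun x => Real.exp (-H x)) {a b : ℝ} (ha : 0 < a) (hb : 0 < b)
    (hab : a + b = 1) (hle : ∀ x y, H (a • x + b • y) ≤ a * F x + b * G y) :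
    (∫ x, Real.exp (-F x)) ^ a * (∫ x, Real.exp (-G x)) ^ b ≤ ∫ x, Real.exp (-H x) := by
  have hpos : ∀ u : EuclideanSpace ℝ (Fin n) → ℝ, 0 ≤ ∫ x, Real.exp (-u x) :=
    fun u => integral_nonneg fun x => (Real.exp_pos _).le
  have htr : ∀ u : EuclideanSpace ℝ (Fin n) → ℝ, Continuous u →
      Integrable (fun x => Real.exp (-u x)) →
      ENNReal.ofReal (∫ x, Real.exp (-u x)) =
        ∫⁻ x : Fin n → ℝ, ENNReal.ofReal (Real.exp (-u (WithLp.toLp 2 x))) := by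
    intro u hu hui
    rw [ofReal_integral_eq_lintegral_ofReal hui (.of_forall fun x => (Real.exp_pos _).le)]
    exact ((PiLp.volume_preserving_toLp (Fin n)).lintegral_comp (by fun_prop)).symm
  refine (ENNReal.ofReal_le_ofReal_iff (hpos H)).1 ?_
  rw [ENNReal.ofReal_mul (Real.rpow_nonneg (hpos F) a),
    ← ENNReal.ofReal_rpow_of_nonneg (hpos F) ha.le, ← ENNReal.ofReal_rpow_of_nonneg (hpos G) hb.le,
    htr F hF hFi, htr G hG hGi, htr H hH hHi]
  refine prekopa_leindler (by fun_prop) (by fun_prop) (by fun_prop) ha hb hab fun x y => ?_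
  rw [ENNReal.ofReal_rpow_of_nonneg (Real.exp_pos _).le ha.le,
    ENNReal.ofReal_rpow_of_nonneg (Real.exp_pos _).le hb.le,
    ← ENNReal.ofReal_mul (by positivity), ← Real.exp_mul, ← Real.exp_mul, ← Real.exp_add]
  refine ENNReal.ofReal_le_ofReal (Real.exp_le_exp.2 ?_)
  have := hle (WithLp.toLp 2 x) (WithLp.toLp 2 y)
  simp only [WithLp.toLp_add, WithLp.toLp_smul]
  linarith

section GaussianReweighting

variable {n : ℕ} {V : EuclideanSpace ℝ (Fin n) → ℝ}

/-- The mass of `e^{-V}` reweighted by a Gaussian factor centred at `m`. -/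
noncomputable def reweightedMass (V : EuclideanSpace ℝ (Fin n) → ℝ) (δ : ℝ)
    (m : EuclideanSpace ℝ (Fin n)) : ℝ :=
  ∫ x, Real.exp (-(δ * ‖x - m‖ ^ 2 / 2)) * Real.exp (-V x)

theorem integrable_reweighted (hVc : Continuous V) (hint : Integrable fun x => Real.exp (-V x))
    {δ : ℝ} (hδ : 0 < δ) (m : EuclideanSpace ℝ (Fin n)) :
    Integrable fun x => Real.exp (-(δ * ‖x - m‖ ^ 2 / 2)) * Real.exp (-V x) := by
  refine hint.mono' (by fun_prop) (.of_forall fun x => ?_)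
  rw [Real.norm_of_nonneg (by positivity)]
  refine mul_le_of_le_one_left (Real.exp_pos _).le (Real.exp_le_one_iff.2 ?_)
  have : 0 ≤ δ * ‖x - m‖ ^ 2 / 2 := by positivity
  linarith

theorem reweightedMass_pos (hVc : Continuous V) (hint : Integrable fun x => Real.exp (-V x))
    {δ : ℝ} (hδ : 0 < δ) (m : EuclideanSpace ℝ (Fin n)) : 0 < reweightedMass V δ m := by
  refine (integral_pos_iff_support_of_nonneg (fun x => by positivity)
    (integrable_reweighted hVc hint hδ m)).2 ?_
  have : Function.support (fun x => Real.exp (-(δ * ‖x - m‖ ^ 2 / 2)) * Real.exp (-V x)) =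
      Set.univ := by
    ext x
    simp [Real.exp_ne_zero]
  rw [this]
  exact Measure.measure_univ_pos.2 (NeZero.ne _)

theorem reweightedMass_lt_integral (hn : 0 < n) (hVc : Continuous V)
    (hint : Integrable fun x => Real.exp (-V x)) {δ : ℝ} (hδ : 0 < δ)
    (m : EuclideanSpace ℝ (Fin n)) :
    reweightedMass V δ m < ∫ x, Real.exp (-V x) := by
  have : Nonempty (Fin n) := ⟨⟨0, hn⟩⟩
  have hle : ∀ x : EuclideanSpace ℝ (Fin n), Real.exp (-(δ * ‖x - m‖ ^ 2 / 2)) ≤ 1 := fun x => by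
    have : 0 ≤ δ * ‖x - m‖ ^ 2 / 2 := by positivity
    exact Real.exp_le_one_iff.2 (by linarith)
  rw [← sub_pos, reweightedMass, ← integral_sub hint (integrable_reweighted hVc hint hδ m)]
  refine (integral_pos_iff_support_of_nonneg (fun x => ?_)
    (hint.sub (integrable_reweighted hVc hint hδ m))).2 ?_
  · exact sub_nonneg.2 (mul_le_of_le_one_left (Real.exp_pos _).le (hle x))
  · refine lt_of_lt_of_le ?_ (measure_mono (s := {m}ᶜ) fun x hx => ?_)
    · exact isOpen_compl_singleton.measure_pos _ (exists_ne m)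
    · have hx0 : 0 < ‖x - m‖ := norm_pos_iff.2 (sub_ne_zero.2 hx)
      have h₁ : Real.exp (-(δ * ‖x - m‖ ^ 2 / 2)) < 1 := Real.exp_lt_one_iff.2 (by
        have : 0 < δ * ‖x - m‖ ^ 2 / 2 := by positivity
        linarith)
      exact (sub_pos.2 (mul_lt_of_lt_one_left (Real.exp_pos _) h₁)).ne'

theorem exp_neg_secondMoment_le_reweightedMass (hV : ConvexOn ℝ Set.univ V)
    (hρ : ∫ x, Real.exp (-V x) = 1) (hint : Integrable fun x => Real.exp (-V x)) {δ : ℝ}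
    (hδ : 0 < δ) (c : EuclideanSpace ℝ (Fin n)) :
    Real.exp (-(δ / 2 * ∫ x, ‖x - c‖ ^ 2 * Real.exp (-V x))) ≤ reweightedMass V δ c := by
  have hVc : Continuous V := continuousOn_univ.1 (hV.continuousOn isOpen_univ)
  set S := ∫ x, ‖x - c‖ ^ 2 * Real.exp (-V x) with hS
  have hmom := hV.integrable_norm_sq_mul_exp_neg hint c
  have hint' := (hint.const_mul (Real.exp (-(δ / 2 * S)) * (1 + δ / 2 * S))).sub
    (hmom.const_mul (Real.exp (-(δ / 2 * S)) * (δ / 2)))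
  have hval : ∫ x, (Real.exp (-(δ / 2 * S)) * (1 + δ / 2 * S) * Real.exp (-V x) -
      Real.exp (-(δ / 2 * S)) * (δ / 2) * (‖x - c‖ ^ 2 * Real.exp (-V x))) =
      Real.exp (-(δ / 2 * S)) := by
    rw [integral_sub (hint.const_mul _) (hmom.const_mul _), integral_const_mul,
      integral_const_mul, hρ, ← hS]
    ring
  rw [← hval]
  refine integral_mono hint' (integrable_reweighted hVc hint hδ c) fun x => ?_
  have h₁ := Real.add_one_le_exp (δ / 2 * S - δ * ‖x - c‖ ^ 2 / 2)
  have h₂ : Real.exp (-(δ * ‖x - c‖ ^ 2 / 2)) =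
      Real.exp (-(δ / 2 * S)) * Real.exp (δ / 2 * S - δ * ‖x - c‖ ^ 2 / 2) := by
    rw [← Real.exp_add]; ring_nf
  simp only [h₂]
  calc _ = Real.exp (-(δ / 2 * S)) * (δ / 2 * S - δ * ‖x - c‖ ^ 2 / 2 + 1) * Real.exp (-V x) := by
        ring
    _ ≤ _ := by gcongr

theorem reweightedMass_rpow_mul_le (hV : ConvexOn ℝ Set.univ V)
    (hint : Integrable fun x => Real.exp (-V x)) {δ : ℝ} (hδ : 0 < δ)
    (m v : EuclideanSpace ℝ (Fin n)) {t : ℝ}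
    (ht₀ : 0 < t) (ht₁ : t < 1) :
    reweightedMass V δ m ^ (1 - t) * reweightedMass V δ (m + v) ^ t ≤
      reweightedMass V δ (m + t • v) := by
  have hVc : Continuous V := continuousOn_univ.1 (hV.continuousOn isOpen_univ)
  have hexp : ∀ p x : EuclideanSpace ℝ (Fin n),
      Real.exp (-(δ * ‖x - p‖ ^ 2 / 2)) * Real.exp (-V x) =
      Real.exp (-(δ * ‖x - p‖ ^ 2 / 2 + V x)) := fun p x => by
    rw [← Real.exp_add]; ring_nf
  have hi := fun p : EuclideanSpace ℝ (Fin n) => integrable_reweighted hVc hint hδ p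
  simp only [reweightedMass, hexp] at hi ⊢
  refine prekopa_leindler_integral_exp_neg (by fun_prop) (by fun_prop) (by fun_prop) (hi _) (hi _)
    (hi _) (sub_pos.2 ht₁) ht₀ (by ring) fun x y => ?_
  have h₁ := hV.2 (Set.mem_univ x) (Set.mem_univ y) (sub_pos.2 ht₁).le ht₀.le (by ring)
  have h₂ : ‖(1 - t) • x + t • y - (m + t • v)‖ ^ 2 ≤
      (1 - t) * ‖x - m‖ ^ 2 + t * ‖y - (m + v)‖ ^ 2 := by
    have hsplit : (1 - t) • x + t • y - (m + t • v) =
        (1 - t) • (x - m) + t • (y - (m + v)) := by module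
    have htri : ‖(1 - t) • x + t • y - (m + t • v)‖ ≤
        (1 - t) * ‖x - m‖ + t * ‖y - (m + v)‖ := by
      rw [hsplit]
      refine (norm_add_le _ _).trans_eq ?_
      rw [norm_smul, norm_smul, Real.norm_of_nonneg (sub_pos.2 ht₁).le, Real.norm_of_nonneg ht₀.le]
    refine (pow_le_pow_left₀ (norm_nonneg _) htri 2).trans ?_
    nlinarith [mul_nonneg (mul_nonneg ht₀.le (sub_pos.2 ht₁).le)
      (sq_nonneg (‖x - m‖ - ‖y - (m + v)‖))]
  simp only [smul_eq_mul] at h₁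
  nlinarith

theorem mul_exp_neg_mul_sq_le {δ : ℝ} (hδ : 0 < δ) (r : ℝ) :
    r * Real.exp (-(δ * r ^ 2 / 2)) ≤ 1 + 2 / δ := by
  rw [Real.exp_neg, ← div_eq_mul_inv, div_le_iff₀ (Real.exp_pos _)]
  have h₁ := Real.add_one_le_exp (δ * r ^ 2 / 2)
  have h₂ : (1 + 2 / δ) * (δ * r ^ 2 / 2 + 1) = δ * r ^ 2 / 2 + 1 + r ^ 2 + 2 / δ := by
    field_simp
    ring
  have h₃ : 0 < 2 / δ := by positivity
  have h₄ : 0 ≤ δ * r ^ 2 / 2 := by positivity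
  nlinarith [mul_le_mul_of_nonneg_left h₁ (by positivity : 0 ≤ 1 + 2 / δ), sq_nonneg (r - 1 / 2)]

theorem hasDerivAt_reweightedMass_of_barycenter (hVc : Continuous V)
    (hint : Integrable fun x => Real.exp (-V x)) {δ : ℝ} (hδ : 0 < δ) {m : EuclideanSpace ℝ (Fin n)}
    (hm : (∫ x, (Real.exp (-(δ * ‖x - m‖ ^ 2 / 2)) * Real.exp (-V x)) • x) =
      (∫ x, Real.exp (-(δ * ‖x - m‖ ^ 2 / 2)) * Real.exp (-V x)) • m)
    (v : EuclideanSpace ℝ (Fin n)) :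
    HasDerivAt (fun t : ℝ => reweightedMass V δ (m + t • v)) 0 0 := by
  have hderiv : ∀ (x : EuclideanSpace ℝ (Fin n)) (t : ℝ), HasDerivAt
      (fun t : ℝ => Real.exp (-(δ * ‖x - (m + t • v)‖ ^ 2 / 2)) * Real.exp (-V x))
      (Real.exp (-(δ * ‖x - (m + t • v)‖ ^ 2 / 2)) * (δ * inner ℝ (x - (m + t • v)) v) *
        Real.exp (-V x)) t := by
    intro x t
    have h₁ : HasDerivAt (fun t : ℝ => x - (m + t • v)) (-v) t := by
      simpa using (((hasDerivAt_id t).smul_const v).const_add m).const_sub x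
    have h₂ := ((((h₁.norm_sq).const_mul δ).div_const 2).neg.exp).mul_const (Real.exp (-V x))
    refine h₂.congr_deriv ?_
    simp only [Pi.neg_apply, inner_neg_right]
    ring
  have hkey := hasDerivAt_integral_of_dominated_loc_of_deriv_le (μ := volume) (𝕜 := ℝ)
    (F := fun t x => Real.exp (-(δ * ‖x - (m + t • v)‖ ^ 2 / 2)) * Real.exp (-V x))
    (F' := fun t x => Real.exp (-(δ * ‖x - (m + t • v)‖ ^ 2 / 2)) *
      (δ * inner ℝ (x - (m + t • v)) v) * Real.exp (-V x))
    (bound := fun x => δ * ‖v‖ * (1 + 2 / δ) * Real.exp (-V x)) (x₀ := 0) (s := Set.univ)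
    Filter.univ_mem (.of_forall fun t => by fun_prop) (by
      simpa using integrable_reweighted hVc hint hδ m) (by fun_prop)
    (.of_forall fun x t _ => ?_) (hint.const_mul _) (.of_forall fun x t _ => hderiv x t)
  · refine hkey.2.congr_deriv ?_
    have hi : Integrable fun x =>
        (Real.exp (-(δ * ‖x - m‖ ^ 2 / 2)) * Real.exp (-V x)) • (x - m) := by
      refine (hint.const_mul (1 + 2 / δ)).mono' (by fun_prop) (.of_forall fun x => ?_)
      rw [norm_smul, Real.norm_of_nonneg (by positivity), mul_right_comm, mul_comm (Real.exp _)]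
      have := mul_exp_neg_mul_sq_le hδ ‖x - m‖
      gcongr
    have hi' := (integrable_reweighted hVc hint hδ m).smul_const m
    have hzero : ∫ x, (Real.exp (-(δ * ‖x - m‖ ^ 2 / 2)) * Real.exp (-V x)) • (x - m) = 0 := by
      have hsum := integral_add hi hi'
      simp only [← smul_add, sub_add_cancel] at hsum
      rw [hm, integral_smul_const] at hsum
      simpa using hsum
    have := integral_inner (𝕜 := ℝ) hi v
    rw [hzero, inner_zero_right] at this
    calc _ = ∫ x, δ * inner ℝ v
          ((Real.exp (-(δ * ‖x - m‖ ^ 2 / 2)) * Real.exp (-V x)) • (x - m)) := by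
          congr 1 with x
          rw [inner_smul_right, real_inner_comm]
          simp only [zero_smul, add_zero]
          ring
      _ = 0 := by rw [integral_const_mul, this, mul_zero]
  · rw [norm_mul, norm_mul, norm_mul, Real.norm_of_nonneg (Real.exp_pos _).le,
      Real.norm_of_nonneg (Real.exp_pos _).le, Real.norm_of_nonneg hδ.le]
    refine mul_le_mul_of_nonneg_right ?_ (Real.exp_pos _).le
    calc _ ≤ Real.exp (-(δ * ‖x - (m + t • v)‖ ^ 2 / 2)) * (δ * (‖x - (m + t • v)‖ * ‖v‖)) := by
          gcongr
          exact norm_inner_le_norm _ _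
      _ = δ * ‖v‖ * (‖x - (m + t • v)‖ * Real.exp (-(δ * ‖x - (m + t • v)‖ ^ 2 / 2))) := by ring
      _ ≤ _ := by
          gcongr
          exact mul_exp_neg_mul_sq_le hδ _

theorem reweightedMass_le_of_barycenter (hV : ConvexOn ℝ Set.univ V)
    (hint : Integrable fun x => Real.exp (-V x)) {δ : ℝ} (hδ : 0 < δ) {m : EuclideanSpace ℝ (Fin n)}
    (hm : (∫ x, (Real.exp (-(δ * ‖x - m‖ ^ 2 / 2)) * Real.exp (-V x)) • x) =
      (∫ x, Real.exp (-(δ * ‖x - m‖ ^ 2 / 2)) * Real.exp (-V x)) • m)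
    (y : EuclideanSpace ℝ (Fin n)) :
    reweightedMass V δ y ≤ reweightedMass V δ m := by
  have hVc : Continuous V := continuousOn_univ.1 (hV.continuousOn isOpen_univ)
  have hpos := fun p : EuclideanSpace ℝ (Fin n) => reweightedMass_pos hVc hint hδ p
  by_contra! hlt
  set L := Real.log (reweightedMass V δ y) - Real.log (reweightedMass V δ m) with hL
  have hL₀ : 0 < L := sub_pos.2 (Real.log_lt_log (hpos m) hlt)
  have hderiv := (hasDerivAt_iff_tendsto_slope.1
    (hasDerivAt_reweightedMass_of_barycenter hVc hint hδ hm (y - m))).mono_left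
    (nhdsWithin_mono 0 (fun t (ht : t ∈ Set.Ioi (0 : ℝ)) => ne_of_gt ht))
  refine (mul_pos (hpos m) hL₀).not_ge (ge_of_tendsto hderiv ?_)
  filter_upwards [Ioo_mem_nhdsGT (zero_lt_one (α := ℝ))] with t ⟨ht₀, ht₁⟩
  have h₁ := reweightedMass_rpow_mul_le hV hint hδ m (y - m) ht₀ ht₁
  rw [add_sub_cancel, Real.rpow_def_of_pos (hpos m), Real.rpow_def_of_pos (hpos y),
    ← Real.exp_add] at h₁
  have h₂ : Real.exp (Real.log (reweightedMass V δ m) * (1 - t) +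
      Real.log (reweightedMass V δ y) * t) = reweightedMass V δ m * Real.exp (t * L) := by
    conv_rhs => rw [← Real.exp_log (hpos m)]
    rw [← Real.exp_add, hL]
    ring_nf
  rw [h₂] at h₁
  have h₃ := mul_le_mul_of_nonneg_left (Real.add_one_le_exp (t * L)) (hpos m).le
  rw [slope_def_field, le_div_iff₀ (by simpa using ht₀)]
  simp only [zero_smul, add_zero, sub_zero]
  linarith

theorem reweightedMass_le_rpow_mul (hVc : Continuous V)
    (hint : Integrable fun x => Real.exp (-V x)) {δ δ₀ : ℝ} (hδ₀ : 0 < δ₀) (hlt : δ₀ < δ) {M : ℝ}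
    (hM : ∀ y : EuclideanSpace ℝ (Fin n), reweightedMass V δ y ≤ M) (c : EuclideanSpace ℝ (Fin n)) :
    reweightedMass V δ₀ c ≤ (δ / δ₀) ^ ((n : ℝ) / 2) * M := by
  have hδ : 0 < δ := hδ₀.trans hlt
  set κ := δ * δ₀ / (δ - δ₀) with hκ
  have hκ₀ : 0 < κ := div_pos (mul_pos hδ hδ₀) (sub_pos.2 hlt)
  have hgauss : ∀ (b : ℝ) (p : EuclideanSpace ℝ (Fin n)), 0 < b →
      ∫ y, Real.exp (-(b * ‖y - p‖ ^ 2 / 2)) = (2 * Real.pi / b) ^ ((n : ℝ) / 2) := by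
    intro b p hb
    rw [integral_sub_right_eq_self
      (fun y : EuclideanSpace ℝ (Fin n) => Real.exp (-(b * ‖y‖ ^ 2 / 2))) p]
    have := GaussianFourier.integral_rexp_neg_mul_sq_norm (V := EuclideanSpace ℝ (Fin n))
      (half_pos hb)
    rw [finrank_euclideanSpace_fin] at this
    rw [show 2 * Real.pi / b = Real.pi / (b / 2) by field_simp, ← this]
    congr 1 with y
    ring_nf
  have hgauss_int : ∀ p : EuclideanSpace ℝ (Fin n),
      Integrable fun y => Real.exp (-(κ * ‖y - p‖ ^ 2 / 2)) := by
    intro p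
    refine Integrable.of_integral_ne_zero ?_
    rw [hgauss κ p hκ₀]
    positivity
  have hsq : ∀ x y : EuclideanSpace ℝ (Fin n), δ * ‖x - y‖ ^ 2 + κ * ‖y - c‖ ^ 2 =
      (δ + κ) * ‖y - (δ + κ)⁻¹ • (δ • x + κ • c)‖ ^ 2 + δ₀ * ‖x - c‖ ^ 2 := by
    intro x y
    have hne : δ - δ₀ ≠ 0 := (sub_pos.2 hlt).ne'
    have hsum : δ + κ = δ ^ 2 / (δ - δ₀) := by rw [hκ]; field_simp; ring
    have h₁ : x - y = (x - c) - (y - c) := by abel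
    have h₂ : y - (δ + κ)⁻¹ • (δ • x + κ • c) = (y - c) - (δ / (δ + κ)) • (x - c) := by
      have hk : κ / (δ + κ) = 1 - δ / (δ + κ) := by field_simp; ring
      rw [smul_add, smul_smul, smul_smul, inv_mul_eq_div, inv_mul_eq_div, hk]
      module
    rw [h₁, h₂, norm_sub_sq_real (x - c) (y - c),
      norm_sub_sq_real (y - c) ((δ / (δ + κ)) • (x - c)), inner_smul_right, norm_smul, mul_pow,
      Real.norm_eq_abs, sq_abs, real_inner_comm (y - c) (x - c), hsum, hκ]
    field_simp
    ring
  have hdouble : Integrable (Function.uncurry fun x y : EuclideanSpace ℝ (Fin n) =>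
      Real.exp (-(δ * ‖x - y‖ ^ 2 / 2)) * Real.exp (-V x) * Real.exp (-(κ * ‖y - c‖ ^ 2 / 2)))
      (volume.prod volume) := by
    refine (hint.mul_prod (hgauss_int c)).mono' (by fun_prop) (.of_forall fun ⟨x, y⟩ => ?_)
    simp only [Function.uncurry]
    rw [Real.norm_of_nonneg (by positivity), mul_assoc]
    refine mul_le_of_le_one_left (by positivity) (Real.exp_le_one_iff.2 ?_)
    have : 0 ≤ δ * ‖x - y‖ ^ 2 / 2 := by positivity
    linarith
  have hleft : ∫ x, ∫ y, Real.exp (-(δ * ‖x - y‖ ^ 2 / 2)) * Real.exp (-V x) *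
      Real.exp (-(κ * ‖y - c‖ ^ 2 / 2)) =
      (2 * Real.pi / (δ + κ)) ^ ((n : ℝ) / 2) * reweightedMass V δ₀ c := by
    rw [reweightedMass, ← integral_const_mul]
    congr 1 with x
    rw [← hgauss (δ + κ) ((δ + κ)⁻¹ • (δ • x + κ • c)) (by positivity), ← integral_mul_const]
    congr 1 with y
    rw [← Real.exp_add, ← Real.exp_add, ← Real.exp_add, ← Real.exp_add]
    congr 1
    linarith [hsq x y]
  have hright : ∫ y, ∫ x, Real.exp (-(δ * ‖x - y‖ ^ 2 / 2)) * Real.exp (-V x) *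
      Real.exp (-(κ * ‖y - c‖ ^ 2 / 2)) ≤ M * (2 * Real.pi / κ) ^ ((n : ℝ) / 2) := by
    rw [← hgauss κ c hκ₀, ← integral_const_mul]
    refine integral_mono hdouble.integral_prod_right ((hgauss_int c).const_mul M) fun y => ?_
    simp only
    rw [integral_mul_const]
    exact mul_le_mul_of_nonneg_right (hM y) (Real.exp_pos _).le
  rw [← integral_integral_swap hdouble, hleft] at hright
  have hratio : 2 * Real.pi / κ = δ / δ₀ * (2 * Real.pi / (δ + κ)) := by
    have hne : δ - δ₀ ≠ 0 := (sub_pos.2 hlt).ne'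
    have hsum : δ + κ = δ ^ 2 / (δ - δ₀) := by rw [hκ]; field_simp; ring
    rw [hsum, hκ]
    field_simp
  rw [hratio, Real.mul_rpow (by positivity) (by positivity)] at hright
  have hC : 0 < (2 * Real.pi / (δ + κ)) ^ ((n : ℝ) / 2) := by positivity
  refine le_of_mul_le_mul_left (hright.trans_eq ?_) hC
  ring

end GaussianReweighting

/-- **Lower bound on the reweighted mass at the fixed point (both regimes).**
For a log-concave probability density `ρ = e^{-V}` on `ℝⁿ`, `δ > 0` and `m_δ` the fixed
point of the reweighted barycenter map, with `Var(ρ) = inf_c ∫ |x-c|² ρ`: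
`-log(∫ e^{-δ|x-m_δ|²/2} ρ) ≤ (δ/2) Var(ρ)` if `δ < n/Var(ρ)`, and
`-log(∫ e^{-δ|x-m_δ|²/2} ρ) ≤ (n/2)(1 + log((δ/n) Var(ρ)))` if `δ ≥ n/Var(ρ)`. -/
theorem reweighted_mass_lower_bound
    {n : ℕ} (hn : 0 < n)
    (V : EuclideanSpace ℝ (Fin n) → ℝ) (hV : ConvexOn ℝ Set.univ V)
    (hρ : (∫ x, Real.exp (-V x)) = 1)
    (δ : ℝ) (hδ : 0 < δ)
    (mδ : EuclideanSpace ℝ (Fin n))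
    (hmδ : (∫ x, (Real.exp (-(δ * ‖x - mδ‖ ^ 2 / 2)) * Real.exp (-V x)) • x) =
      (∫ x, Real.exp (-(δ * ‖x - mδ‖ ^ 2 / 2)) * Real.exp (-V x)) • mδ)
    (Vr : ℝ) (hVr : Vr = ⨅ c : EuclideanSpace ℝ (Fin n), ∫ x, ‖x - c‖ ^ 2 * Real.exp (-V x)) :
    (δ < n / Vr →
      -Real.log (∫ x, Real.exp (-(δ * ‖x - mδ‖ ^ 2 / 2)) * Real.exp (-V x)) ≤
        δ / 2 * Vr) ∧
    (δ ≥ n / Vr →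
      -Real.log (∫ x, Real.exp (-(δ * ‖x - mδ‖ ^ 2 / 2)) * Real.exp (-V x)) ≤
        n / 2 * (1 + Real.log (δ / n * Vr))) := by
  have hint : Integrable fun x => Real.exp (-V x) :=
    Integrable.of_integral_ne_zero (by rw [hρ]; exact one_ne_zero)
  have hVc : Continuous V := continuousOn_univ.1 (hV.continuousOn isOpen_univ)
  have hmax := reweightedMass_le_of_barycenter hV hint hδ hmδ
  have hpos := reweightedMass_pos hVc hint hδ mδ
  have hlt_one := reweightedMass_lt_integral hn hVc hint hδ mδ
  rw [hρ] at hlt_one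
  change (_ → -Real.log (reweightedMass V δ mδ) ≤ _) ∧
    (_ → -Real.log (reweightedMass V δ mδ) ≤ _)
  set Z := reweightedMass V δ mδ
  have le_of_forall : ∀ X a : ℝ, 0 < a →
      (∀ c : EuclideanSpace ℝ (Fin n), X ≤ a * ∫ x, ‖x - c‖ ^ 2 * Real.exp (-V x)) →
      X ≤ a * Vr := by
    intro X a ha h
    rw [← div_le_iff₀' ha, hVr]
    exact le_ciInf fun c => (div_le_iff₀' ha).2 (h c)
  have hsmall : -Real.log Z ≤ δ / 2 * Vr := by
    refine le_of_forall _ _ (half_pos hδ) fun c => ?_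
    have := (Real.le_log_iff_exp_le hpos).2
      ((exp_neg_secondMoment_le_reweightedMass hV hρ hint hδ c).trans (hmax c))
    linarith
  have hVr₀ : 0 < Vr := by
    have := Real.log_neg hpos hlt_one
    exact pos_of_mul_pos_right (by linarith) (half_pos hδ).le
  have hn' : (0 : ℝ) < n := by exact_mod_cast hn
  refine ⟨fun _ => hsmall, fun hge => ?_⟩
  rcases eq_or_lt_of_le hge with heq | hlt
  · have h₁ : δ * Vr = n := by rw [← heq]; field_simp
    have h₂ : δ / n * Vr = 1 := by rw [div_mul_eq_mul_div, h₁, div_self hn'.ne']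
    rw [h₂, Real.log_one]
    linarith
  · set δ₀ := (n : ℝ) / Vr with hδ₀
    have hδ₀' : 0 < δ₀ := by positivity
    have h₁ : -Real.log Z - n / 2 * Real.log (δ / δ₀) ≤ δ₀ / 2 * Vr := by
      refine le_of_forall _ _ (half_pos hδ₀') fun c => ?_
      have h := (exp_neg_secondMoment_le_reweightedMass hV hρ hint hδ₀' c).trans
        (reweightedMass_le_rpow_mul hVc hint hδ₀' hlt hmax c)
      have hr : 0 < (δ / δ₀) ^ ((n : ℝ) / 2) := by positivity
      have := (Real.le_log_iff_exp_le (mul_pos hr hpos)).2 h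
      rw [Real.log_mul hr.ne' hpos.ne', Real.log_rpow (by positivity)] at this
      linarith
    have h₂ : δ / δ₀ = δ / n * Vr := by rw [hδ₀]; field_simp
    have h₃ : δ₀ / 2 * Vr = n / 2 := by rw [hδ₀]; field_simp
    rw [h₂, h₃] at h₁
    linarith
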